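/- Let G be a finite abelian group, 1 ≤ k ≤ |G|, and let A ⊆ G, B ⊆ Ĝ with |A| = k and |B| = θ(k, G). Then the space E(A,B) of functions f : G → ℂ with supp(f) ⊆ A and supp(f̂) ⊆ B has dimension at most 1. -/

import Mathlib

open Function

/-- The Fourier transform of `f : G → ℂ` on a finite abelian group `G`, as a function on the
dual group of characters: `f̂(χ) = ∑ x, f x * χ(-x)`. -/
noncomputable def dft (G : Type*) [AddCommGroup G] [Fintype G] (f : G → ℂ) :
    AddChar G ℂ → ℂ :=
  fun χ => ∑ x : G, f x * χ (-x)

/-- Meshulam's function `θ(k, G)`: the minimal size of the spectrum of a nonzero function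
on `G` whose support has size at most `k`. -/
noncomputable def theta (G : Type*) [AddCommGroup G] [Fintype G] (k : ℕ) : ℕ :=
  sInf {l | ∃ f : G → ℂ, f ≠ 0 ∧ (support f).ncard ≤ k ∧ (support (dft G f)).ncard = l}

lemma dft_zero (G : Type*) [AddCommGroup G] [Fintype G] : dft G (0 : G → ℂ) = 0 := by
  funext χ; simp [dft]

lemma dft_add (G : Type*) [AddCommGroup G] [Fintype G] (f g : G → ℂ) :
    dft G (f + g) = dft G f + dft G g := by
  funext χ; simp [dft, add_mul, Finset.sum_add_distrib]

lemma dft_smul (G : Type*) [AddCommGroup G] [Fintype G] (c : ℂ) (f : G → ℂ) :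
    dft G (c • f) = c • dft G f := by
  funext χ; simp [dft, Finset.mul_sum, mul_assoc]

/-- For `A ⊆ G` and `B ⊆ Ĝ`, the space `E(A, B)` of functions with support in `A`
and spectrum in `B`. -/
noncomputable def E (G : Type*) [AddCommGroup G] [Fintype G]
    (A : Set G) (B : Set (AddChar G ℂ)) : Submodule ℂ (G → ℂ) where
  carrier := {f | support f ⊆ A ∧ support (dft G f) ⊆ B}
  zero_mem' := ⟨by simp, by rw [dft_zero]; simp⟩
  add_mem' := fun {f g} hf hg =>
    ⟨(support_add f g).trans (Set.union_subset hf.1 hg.1), by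
      rw [dft_add]
      exact (support_add _ _).trans (Set.union_subset hf.2 hg.2)⟩
  smul_mem' := fun c f hf =>
    ⟨(support_const_smul_subset c f).trans hf.1, by
      rw [dft_smul]
      exact (support_const_smul_subset c _).trans hf.2⟩

/-- Fourier inversion, up to normalisation. -/
lemma sum_dft_mul_apply (G : Type*) [AddCommGroup G] [Fintype G] (f : G → ℂ) (y : G) :
    ∑ χ : AddChar G ℂ, dft G f χ * χ y = Fintype.card G * f y := by
  classical
  simp only [dft, Finset.sum_mul, mul_assoc, ← AddChar.map_add_eq_mul]
  rw [Finset.sum_comm]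
  simp only [← Finset.mul_sum, AddChar.sum_apply_eq_ite, neg_add_eq_zero]
  simp [mul_comm]

lemma eq_zero_of_dft_eq_zero (G : Type*) [AddCommGroup G] [Fintype G] {f : G → ℂ}
    (hf : dft G f = 0) : f = 0 := by
  funext y
  simpa [hf, Fintype.card_ne_zero] using sum_dft_mul_apply G f y

/-- A nonzero function in `E(A, B)` with `|A| ≤ k` and `|B| = θ(k, G)` has spectrum all of `B`. -/
lemma support_dft_eq_of_mem_E {G : Type*} [AddCommGroup G] [Fintype G] {k : ℕ} {A : Set G}
    {B : Set (AddChar G ℂ)} (hA : A.ncard ≤ k) (hB : B.ncard = theta G k) {f : G → ℂ}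
    (hf : f ∈ E G A B) (h0 : f ≠ 0) : support (dft G f) = B :=
  Set.eq_of_subset_of_ncard_le hf.2
    (hB.trans_le (Nat.sInf_le ⟨f, h0, (Set.ncard_le_ncard hf.1).trans hA, rfl⟩))

/-- Evaluation of the Fourier transform at a character, as a linear functional. -/
noncomputable def dftEval (G : Type*) [AddCommGroup G] [Fintype G] (χ : AddChar G ℂ) :
    (G → ℂ) →ₗ[ℂ] ℂ where
  toFun f := dft G f χ
  map_add' f g := by rw [dft_add]; rfl
  map_smul' c f := by rw [dft_smul]; rfl

/-- If `|A| = k` and `|B| = θ(k, G)`, then `E(A, B)` has dimension at most `1`. -/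
theorem finrank_E_le_one (G : Type*) [AddCommGroup G] [Fintype G] (k : ℕ)
    (hk1 : 1 ≤ k) (hk2 : k ≤ Fintype.card G) (A : Set G) (B : Set (AddChar G ℂ))
    (hA : A.ncard = k) (hB : B.ncard = theta G k) :
    Module.finrank ℂ (E G A B) ≤ 1 := by
  obtain rfl | ⟨χ, hχ⟩ := B.eq_empty_or_nonempty
  · have hE : E G A ∅ = ⊥ := (Submodule.eq_bot_iff _).2 fun f hf =>
      eq_zero_of_dft_eq_zero G (support_eq_empty_iff.1 (Set.subset_empty_iff.1 hf.2))
    rw [hE, finrank_bot]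
    exact zero_le_one
  · have hinj : Injective ((dftEval G χ).domRestrict (E G A B)) := by
      refine (injective_iff_map_eq_zero _).2 fun f hf => ?_
      by_contra h0
      rw [← support_dft_eq_of_mem_E hA.le hB f.2 fun h => h0 (Subtype.ext h)] at hχ
      exact hχ hf
    simpa using LinearMap.finrank_le_finrank_of_injective hinj
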